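/- Let G be a maximal bipartite outerplanar graph with at least one edge, and let {u,w} be an edge of G such that u and w are consecutive in some circle drawing of G. Let p₁, p₂ ∈ ℝ² with dist(p₁,p₂) = 1 and let d₁, d₂ be unit vectors lying in the same open half-plane bounded by the line through p₁ and p₂, such that α₁ + α₂ > π, where α₁ is the angle between d₁ and p₂ − p₁ and α₂ is the angle between d₂ and p₁ − p₂. Then G admits a planar straight-line drawing ρ with ρ(u) = p₁ and ρ(w) = p₂ in which every edge has length exactly 1 and the closed segment of every edge is contained in the wedge W(p₁, p₂, d₁, d₂). -/

import Mathlib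

noncomputable section

/-- The Euclidean plane. -/
abbrev Plane : Type := EuclideanSpace ℝ (Fin 2)

/-- A planar straight-line drawing of a simple graph `G`. -/
def IsPlanarDrawing {V : Type} (G : SimpleGraph V) (ρ : V → Plane) : Prop :=
  Function.Injective ρ ∧
  (∀ u v w : V, G.Adj u v → w ≠ u → w ≠ v → ρ w ∉ segment ℝ (ρ u) (ρ v)) ∧
  (∀ u v x y : V, G.Adj u v → G.Adj x y → s(u, v) ≠ s(x, y) →
    segment ℝ (ρ u) (ρ v) ∩ segment ℝ (ρ x) (ρ y) =
      {p : Plane | ∃ w : V, (w = u ∨ w = v) ∧ (w = x ∨ w = y) ∧ p = ρ w})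

/-- A graph is outerplanar if it admits a planar straight-line drawing with all vertex
images on a common circle. -/
def IsOuterplanar {V : Type} (G : SimpleGraph V) : Prop :=
  ∃ (ρ : V → Plane) (c : Plane) (r : ℝ),
    IsPlanarDrawing G ρ ∧ ∀ v : V, dist (ρ v) c = r

/-- A graph is maximal bipartite outerplanar if it is bipartite (2-colorable) and
outerplanar, and adding any missing edge destroys bipartiteness or outerplanarity. -/
def IsMaximalBipartiteOuterplanar {V : Type} (G : SimpleGraph V) : Prop :=
  G.Colorable 2 ∧ IsOuterplanar G ∧
  ∀ x y : V, x ≠ y → ¬ G.Adj x y →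
    ¬ ((G ⊔ SimpleGraph.fromEdgeSet {s(x, y)}).Colorable 2 ∧
       IsOuterplanar (G ⊔ SimpleGraph.fromEdgeSet {s(x, y)}))

/-- The planar cross product of two vectors. -/
def cross2 (a b : Plane) : ℝ := a 0 * b 1 - a 1 * b 0

/-- The closed half-plane bounded by the line through `p` with direction `dir` that
contains the reference point `ref` (assumed off the line). -/
def closedHalfPlane (p dir ref : Plane) : Set Plane :=
  {x : Plane | 0 ≤ cross2 dir (x - p) * cross2 dir (ref - p)}

/-- The wedge `W(p₁, p₂, d₁, d₂)`: intersection of the closed half-plane bounded by the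
line through `p₁`, `p₂` containing `p₁ + d₁`, the closed half-plane bounded by the line
through `p₁` with direction `d₁` containing `p₂`, and the closed half-plane bounded by the
line through `p₂` with direction `d₂` containing `p₁`. -/
def wedge (p₁ p₂ d₁ d₂ : Plane) : Set Plane :=
  closedHalfPlane p₁ (p₂ - p₁) (p₁ + d₁) ∩
  closedHalfPlane p₁ d₁ p₂ ∩
  closedHalfPlane p₂ d₂ p₁

/-- Vertices `u`, `w` are consecutive in some circle drawing of `G`: there is a planar
straight-line drawing `σ` with all vertex images on a common circle such that all other
vertex images lie strictly on one side of the chord through `σ u`, `σ w` (equivalently,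
one of the two open arcs between `σ u` and `σ w` contains no vertex image). -/
def ConsecutiveInSomeCircleDrawing {V : Type} (G : SimpleGraph V) (u w : V) : Prop :=
  ∃ (σ : V → Plane) (c : Plane) (r : ℝ),
    IsPlanarDrawing G σ ∧ (∀ x : V, dist (σ x) c = r) ∧
    ((∀ x : V, x ≠ u → x ≠ w → 0 < cross2 (σ w - σ u) (σ x - σ u)) ∨
     (∀ x : V, x ≠ u → x ≠ w → cross2 (σ w - σ u) (σ x - σ u) < 0))


/-! ### The planar cross product -/

theorem cross2_plucker (b v e d : Plane) :
    cross2 b v * cross2 e d = cross2 v d * cross2 b e + cross2 e v * cross2 b d := by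
  simp only [cross2]; ring

theorem cross2_add_left (x y z : Plane) : cross2 (x + y) z = cross2 x z + cross2 y z := by
  simp only [cross2, PiLp.add_apply]; ring

theorem cross2_add_right (x y z : Plane) : cross2 x (y + z) = cross2 x y + cross2 x z := by
  simp only [cross2, PiLp.add_apply]; ring

theorem cross2_sub_left (x y z : Plane) : cross2 (x - y) z = cross2 x z - cross2 y z := by
  simp only [cross2, PiLp.sub_apply]; ring

theorem cross2_sub_right (x y z : Plane) : cross2 x (y - z) = cross2 x y - cross2 x z := by
  simp only [cross2, PiLp.sub_apply]; ring

theorem cross2_smul_left (t : ℝ) (x y : Plane) : cross2 (t • x) y = t * cross2 x y := by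
  simp only [cross2, PiLp.smul_apply, smul_eq_mul]; ring

theorem cross2_smul_right (t : ℝ) (x y : Plane) : cross2 x (t • y) = t * cross2 x y := by
  simp only [cross2, PiLp.smul_apply, smul_eq_mul]; ring

theorem cross2_neg_left (x y : Plane) : cross2 (-x) y = -cross2 x y := by
  simp only [cross2, PiLp.neg_apply]; ring

theorem cross2_neg_right (x y : Plane) : cross2 x (-y) = -cross2 x y := by
  simp only [cross2, PiLp.neg_apply]; ring

@[simp] theorem cross2_self (x : Plane) : cross2 x x = 0 := by
  simp only [cross2]; ring

theorem cross2_swap (x y : Plane) : cross2 y x = -cross2 x y := by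
  simp only [cross2]; ring

theorem eq_zero_of_cross2_eq_zero {x y z : Plane} (hy : cross2 x y = 0) (hz : cross2 x z = 0)
    (h : cross2 y z ≠ 0) : x = 0 := by
  simp only [cross2] at hy hz h
  ext i
  fin_cases i
  · refine (mul_eq_zero.1 (?_ : x 0 * _ = 0)).resolve_right h
    linear_combination y 0 * hz - z 0 * hy
  · refine (mul_eq_zero.1 (?_ : x 1 * _ = 0)).resolve_right h
    linear_combination y 1 * hz - z 1 * hy

/-! ### Positively oriented wedges -/

/-- The part of the plane to the left of the directed segment from `p` to `q`, cut off by the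
rays from `p` in direction `d₁` and from `q` in direction `d₂`. -/
def leftWedge (p q d₁ d₂ : Plane) : Set Plane :=
  {x | 0 ≤ cross2 (q - p) (x - p) ∧ 0 ≤ cross2 (x - p) d₁ ∧ 0 ≤ cross2 d₂ (x - q)}

theorem mem_leftWedge {p q d₁ d₂ x : Plane} : x ∈ leftWedge p q d₁ d₂ ↔
    0 ≤ cross2 (q - p) (x - p) ∧ 0 ≤ cross2 (x - p) d₁ ∧ 0 ≤ cross2 d₂ (x - q) :=
  Iff.rfl

/-- The directions `d₁` and `d₂` point to the left of `b`, and `d₁` is to the left of `d₂`. -/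
structure Diverges (b d₁ d₂ : Plane) : Prop where
  left_fst : 0 < cross2 b d₁
  left_snd : 0 < cross2 b d₂
  diverge : 0 < cross2 d₂ d₁

theorem convex_leftWedge (p q d₁ d₂ : Plane) : Convex ℝ (leftWedge p q d₁ d₂) := by
  rintro x ⟨hx₁, hx₂, hx₃⟩ y ⟨hy₁, hy₂, hy₃⟩ s t hs ht hst
  obtain rfl : t = 1 - s := by linarith
  rw [mem_leftWedge]
  refine ⟨?_, ?_, ?_⟩
  · refine (add_nonneg (mul_nonneg hs hx₁) (mul_nonneg ht hy₁)).trans_eq ?_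
    simp only [cross2, PiLp.add_apply, PiLp.sub_apply, PiLp.smul_apply, smul_eq_mul]; ring
  · refine (add_nonneg (mul_nonneg hs hx₂) (mul_nonneg ht hy₂)).trans_eq ?_
    simp only [cross2, PiLp.add_apply, PiLp.sub_apply, PiLp.smul_apply, smul_eq_mul]; ring
  · refine (add_nonneg (mul_nonneg hs hx₃) (mul_nonneg ht hy₃)).trans_eq ?_
    simp only [cross2, PiLp.add_apply, PiLp.sub_apply, PiLp.smul_apply, smul_eq_mul]; ring

theorem Diverges.left_mem {p q d₁ d₂ : Plane} (h : Diverges (q - p) d₁ d₂) :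
    p ∈ leftWedge p q d₁ d₂ := by
  refine ⟨by simp [cross2], by simp [cross2], ?_⟩
  have := h.left_snd.le
  rwa [cross2_swap, ← cross2_neg_right, neg_sub] at this

theorem Diverges.right_mem {p q d₁ d₂ : Plane} (h : Diverges (q - p) d₁ d₂) :
    q ∈ leftWedge p q d₁ d₂ := by
  refine ⟨by simp, h.left_fst.le, ?_⟩
  simp [cross2]

/-- A vector not to the right of `b`, with `g` not to its right, has `f` not to its right, for any
`f` to the left of `g`. -/
theorem cross2_nonneg_of_sector {b v g f : Plane} (hbv : 0 ≤ cross2 b v) (hvg : 0 ≤ cross2 v g)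
    (hgf : 0 ≤ cross2 g f) (hbg : 0 < cross2 b g) (hbf : 0 ≤ cross2 b f) : 0 ≤ cross2 v f := by
  have h := cross2_plucker b v g f
  rw [cross2_swap v g] at h
  refine nonneg_of_mul_nonneg_left (b := cross2 b g) ?_ hbg
  nlinarith [mul_nonneg hbv hgf, mul_nonneg hvg hbf]

/-- Mirror image of `cross2_nonneg_of_sector`. -/
theorem cross2_nonneg_of_sector' {b v g f : Plane} (hbv : 0 ≤ cross2 b v) (hvg : 0 ≤ cross2 g v)
    (hgf : 0 ≤ cross2 f g) (hbg : 0 < cross2 b g) (hbf : 0 ≤ cross2 b f) : 0 ≤ cross2 f v := by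
  have h := cross2_plucker b v f g
  rw [cross2_swap g v] at h
  refine nonneg_of_mul_nonneg_left (b := cross2 b g) ?_ hbg
  nlinarith [mul_nonneg hbv hgf, mul_nonneg hvg hbf]

theorem cross2_nonneg_of_cone {a v e d : Plane} (hev : 0 ≤ cross2 e v) (hvd : 0 ≤ cross2 v d)
    (hed : 0 < cross2 e d) (hae : 0 ≤ cross2 a e) (had : 0 ≤ cross2 a d) : 0 ≤ cross2 a v := by
  refine nonneg_of_mul_nonneg_left (b := cross2 e d) ?_ hed
  rw [cross2_plucker]
  exact add_nonneg (mul_nonneg hvd hae) (mul_nonneg hev had)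

theorem eq_zero_of_sectors {b v g f : Plane} (hbv : 0 ≤ cross2 b v) (hvg : 0 ≤ cross2 v g)
    (hfv : 0 ≤ cross2 f v) (hgf : 0 < cross2 g f) (hbg : 0 < cross2 b g) (hbf : 0 < cross2 b f) :
    v = 0 := by
  have h := cross2_plucker b v g f
  rw [cross2_swap v g, cross2_swap f v] at h
  have h₁ := mul_nonneg hbv hgf.le
  have h₂ := mul_nonneg hvg hbf.le
  have h₃ := mul_nonneg hfv hbg.le
  have hg : cross2 v g = 0 := by
    refine (mul_eq_zero.1 (?_ : _ * cross2 b f = 0)).resolve_right hbf.ne'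
    linarith
  have hf : cross2 f v = 0 := by
    refine (mul_eq_zero.1 (?_ : _ * cross2 b g = 0)).resolve_right hbg.ne'
    linarith
  refine eq_zero_of_cross2_eq_zero hg (z := f) ?_ hgf.ne'
  rw [cross2_swap, hf, neg_zero]

/-- A divergent wedge based on the unit segment from `p` to `q` contains a rhombus on this base,
together with divergent wedges based on the other three sides, which meet each other and the base
only at common corners. -/
theorem Diverges.exists_rhombus {p q d₁ d₂ : Plane} (h : Diverges (q - p) d₁ d₂) :
    ∃ p' q' f₁ g₁ g₂ f₂ : Plane, dist p p' = 1 ∧ dist p' q' = dist p q ∧ dist q' q = 1 ∧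
      Diverges (p' - p) d₁ f₁ ∧ Diverges (q' - p') g₁ g₂ ∧ Diverges (q - q') f₂ d₂ ∧
      leftWedge p p' d₁ f₁ ⊆ leftWedge p q d₁ d₂ ∧
      leftWedge p' q' g₁ g₂ ⊆ leftWedge p q d₁ d₂ ∧
      leftWedge q' q f₂ d₂ ⊆ leftWedge p q d₁ d₂ ∧
      (∀ x ∈ segment ℝ p q, x ∈ leftWedge p p' d₁ f₁ → x = p) ∧
      (∀ x ∈ segment ℝ p q, x ∉ leftWedge p' q' g₁ g₂) ∧
      (∀ x ∈ segment ℝ p q, x ∈ leftWedge q' q f₂ d₂ → x = q) ∧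
      (∀ x ∈ leftWedge p p' d₁ f₁, x ∈ leftWedge p' q' g₁ g₂ → x = p') ∧
      (∀ x ∈ leftWedge p p' d₁ f₁, x ∉ leftWedge q' q f₂ d₂) ∧
      (∀ x ∈ leftWedge p' q' g₁ g₂, x ∈ leftWedge q' q f₂ d₂ → x = q') := by
  obtain ⟨h₁, h₂, h₃⟩ := h
  obtain ⟨b, rfl⟩ : ∃ b, q = p + b := ⟨q - p, by abel⟩
  rw [add_sub_cancel_left] at h₁ h₂
  have hd : d₁ + d₂ ≠ 0 := by
    intro h0
    have : cross2 b (d₁ + d₂) = 0 := by rw [h0]; simp [cross2]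
    rw [cross2_add_right] at this
    linarith
  obtain ⟨e, he, hbe, hed, hde⟩ : ∃ e : Plane, ‖e‖ = 1 ∧ 0 < cross2 b e ∧ 0 < cross2 e d₁ ∧
      0 < cross2 d₂ e := by
    have ht : 0 < ‖d₁ + d₂‖⁻¹ := inv_pos.2 (norm_pos_iff.2 hd)
    refine ⟨‖d₁ + d₂‖⁻¹ • (d₁ + d₂), norm_smul_inv_norm hd, ?_, ?_, ?_⟩ <;>
      simp only [cross2_smul_left, cross2_smul_right, cross2_add_left, cross2_add_right,
        cross2_self] <;> apply mul_pos ht <;> linarith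
  have hf₁ : 0 < cross2 e (e + d₁) := by simpa [cross2_add_right] using hed
  have hfd₁ : 0 < cross2 (e + d₁) d₁ := by simpa [cross2_add_left] using hed
  have hbf₁ : 0 < cross2 b (e + d₁) := by rw [cross2_add_right]; linarith
  have hf₂ : 0 < cross2 (e + d₂) e := by simpa [cross2_add_left] using hde
  have hfd₂ : 0 < cross2 d₂ (e + d₂) := by simpa [cross2_add_right] using hde
  have hbf₂ : 0 < cross2 b (e + d₂) := by rw [cross2_add_right]; linarith
  generalize e + d₁ = f₁ at *
  generalize e + d₂ = f₂ at *
  have hg₁ : 0 < cross2 e (e + f₁) := by simpa [cross2_add_right] using hf₁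
  have hgf₁ : 0 < cross2 (e + f₁) f₁ := by simpa [cross2_add_left] using hf₁
  have hgd₁ : 0 < cross2 (e + f₁) d₁ := by rw [cross2_add_left]; linarith
  have hbg₁ : 0 < cross2 b (e + f₁) := by rw [cross2_add_right]; linarith
  have hg₂ : 0 < cross2 (e + f₂) e := by simpa [cross2_add_left] using hf₂
  have hgf₂ : 0 < cross2 f₂ (e + f₂) := by simpa [cross2_add_right] using hf₂
  have hgd₂ : 0 < cross2 d₂ (e + f₂) := by rw [cross2_add_right]; linarith
  have hbg₂ : 0 < cross2 b (e + f₂) := by rw [cross2_add_right]; linarith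
  generalize e + f₁ = g₁ at *
  generalize e + f₂ = g₂ at *
  have hgg : 0 < cross2 g₂ g₁ := by
    have := cross2_plucker b e g₂ g₁
    nlinarith [mul_pos hg₁ hbg₂, mul_pos hg₂ hbg₁]
  have hW (v : Plane) : p + v ∈ leftWedge p (p + b) d₁ d₂ ↔
      0 ≤ cross2 b v ∧ 0 ≤ cross2 v d₁ ∧ 0 ≤ cross2 d₂ (v - b) := by
    rw [mem_leftWedge, add_sub_cancel_left, add_sub_cancel_left, add_sub_add_left_eq_sub]
  have hL (v : Plane) : p + v ∈ leftWedge p (p + e) d₁ f₁ ↔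
      0 ≤ cross2 e v ∧ 0 ≤ cross2 v d₁ ∧ 0 ≤ cross2 f₁ (v - e) := by
    rw [mem_leftWedge, add_sub_cancel_left, add_sub_cancel_left, add_sub_add_left_eq_sub]
  have hT (v : Plane) : p + v ∈ leftWedge (p + e) (p + b + e) g₁ g₂ ↔
      0 ≤ cross2 b (v - e) ∧ 0 ≤ cross2 (v - e) g₁ ∧ 0 ≤ cross2 g₂ (v - b - e) := by
    rw [mem_leftWedge, add_sub_add_right_eq_sub, add_sub_cancel_left, add_sub_add_left_eq_sub,
      add_assoc, add_sub_add_left_eq_sub, sub_sub]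
  have hR (v : Plane) : p + v ∈ leftWedge (p + b + e) (p + b) f₂ d₂ ↔
      0 ≤ cross2 (v - b) e ∧ 0 ≤ cross2 (v - b - e) f₂ ∧ 0 ≤ cross2 d₂ (v - b) := by
    rw [mem_leftWedge, sub_add_cancel_left, add_sub_add_left_eq_sub, add_assoc,
      add_sub_add_left_eq_sub, sub_sub, ← sub_sub v b e, cross2_neg_left, ← cross2_swap,
      cross2_sub_left (v - b), cross2_self, sub_zero]
  have hseg : ∀ x ∈ segment ℝ p (p + b), ∃ t : ℝ, 0 ≤ t ∧ t ≤ 1 ∧ x = p + t • b := by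
    intro x hx
    rw [segment_eq_image'] at hx
    obtain ⟨t, ⟨ht₀, ht₁⟩, rfl⟩ := hx
    exact ⟨t, ht₀, ht₁, by simp⟩
  have hall {P : Plane → Prop} (h : ∀ v, P (p + v)) (x : Plane) : P x := by
    simpa using h (x - p)
  refine ⟨p + e, p + b + e, f₁, g₁, g₂, f₂, ?_, ?_, ?_, ?_, ?_, ?_, ?_, ?_, ?_, ?_, ?_, ?_, ?_, ?_,
    ?_⟩
  · simp [dist_eq_norm, he]
  · simp
  · simp [dist_eq_norm, he]
  · rw [add_sub_cancel_left]
    exact ⟨hed, hf₁, hfd₁⟩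
  · rw [add_sub_add_right_eq_sub, add_sub_cancel_left]
    exact ⟨hbg₁, hbg₂, hgg⟩
  · rw [sub_add_cancel_left]
    refine ⟨?_, ?_, hfd₂⟩ <;> rw [cross2_neg_left, ← cross2_swap]
    exacts [hf₂, hde]
  · refine hall fun v hv ↦ ?_
    rw [hL] at hv
    obtain ⟨hv₁, hv₂, -⟩ := hv
    refine (hW v).2 ⟨cross2_nonneg_of_cone hv₁ hv₂ hed hbe.le h₁.le, hv₂, ?_⟩
    rw [cross2_sub_right, cross2_swap b d₂]
    linarith [cross2_nonneg_of_cone hv₁ hv₂ hed hde.le h₃.le]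
  · refine hall fun v hv ↦ ?_
    rw [hT] at hv
    obtain ⟨hv₁, hv₂, hv₃⟩ := hv
    have hv₄ : 0 ≤ cross2 b (v - b - e) := by
      simpa [cross2_sub_right] using hv₁
    have hl := cross2_nonneg_of_sector hv₁ hv₂ hgd₁.le hbg₁ h₁.le
    have hr := cross2_nonneg_of_sector' hv₄ hv₃ hgd₂.le hbg₂ h₂.le
    rw [cross2_sub_right] at hv₁
    rw [cross2_sub_left] at hl
    rw [cross2_sub_right] at hr
    exact (hW v).2 ⟨by linarith, by linarith, by linarith⟩
  · refine hall fun v hv ↦ ?_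
    rw [hR] at hv
    obtain ⟨hv₁, -, hv₃⟩ := hv
    have hb := cross2_nonneg_of_cone hv₃ hv₁ hde h₂.le hbe.le
    have hd := cross2_nonneg_of_cone (a := -d₁) hv₃ hv₁ hde
      (by rw [cross2_neg_left, ← cross2_swap]; exact h₃.le)
      (by rw [cross2_neg_left, ← cross2_swap]; exact hed.le)
    rw [cross2_sub_right, cross2_self, sub_zero] at hb
    rw [cross2_neg_left, ← cross2_swap, cross2_sub_left] at hd
    exact (hW v).2 ⟨hb, by linarith, hv₃⟩
  · intro x hx hxL
    obtain ⟨t, ht₀, ht₁, rfl⟩ := hseg x hx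
    have := ((hL _).1 hxL).1
    rw [cross2_smul_right, cross2_swap b e] at this
    obtain rfl : t = 0 := by nlinarith
    simp
  · intro x hx hxT
    obtain ⟨t, ht₀, ht₁, rfl⟩ := hseg x hx
    have := ((hT _).1 hxT).1
    rw [cross2_sub_right, cross2_smul_right, cross2_self] at this
    linarith
  · intro x hx hxR
    obtain ⟨t, ht₀, ht₁, rfl⟩ := hseg x hx
    have := ((hR _).1 hxR).1
    rw [cross2_sub_left, cross2_smul_left] at this
    obtain rfl : t = 1 := by nlinarith
    simp
  · refine hall fun v hv hvT ↦ ?_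
    obtain ⟨-, -, hv₁⟩ := (hL v).1 hv
    obtain ⟨hv₂, hv₃, -⟩ := (hT v).1 hvT
    rw [sub_eq_zero.1 (eq_zero_of_sectors hv₂ hv₃ hv₁ hgf₁ hbg₁ hbf₁)]
  · refine hall fun v hv hvR ↦ ?_
    have hv₁ := ((hL v).1 hv).1
    have hv₂ := ((hR v).1 hvR).1
    rw [cross2_sub_left, cross2_swap e v] at hv₂
    linarith
  · refine hall fun v hv hvR ↦ ?_
    obtain ⟨hv₁, -, hv₂⟩ := (hT v).1 hv
    obtain ⟨-, hv₃, -⟩ := (hR v).1 hvR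
    have hv₄ : 0 ≤ cross2 b (v - b - e) := by
      simpa [cross2_sub_right] using hv₁
    have := eq_zero_of_sectors hv₄ hv₃ hv₂ hgf₂ hbf₂ hbg₂
    rw [sub_sub, sub_eq_zero] at this
    rw [this, add_assoc]

/-! ### Gluing drawings -/

/-- For a placement `ρ` of indices in the plane, any two distinct vertices or edges, the first
inside `I` and the second inside `J`, have only images of common vertices in common. -/
def Separated {ι : Type} (E : ι → ι → Prop) (ρ : ι → Plane) (I J : Set ι) : Prop :=
  ∀ i ∈ I, ∀ j ∈ I, ∀ k ∈ J, ∀ l ∈ J, (i = j ∨ E i j) → (k = l ∨ E k l) → s(i, j) ≠ s(k, l) →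
    ∀ p ∈ segment ℝ (ρ i) (ρ j), p ∈ segment ℝ (ρ k) (ρ l) →
      ∃ m, (m = i ∨ m = j) ∧ (m = k ∨ m = l) ∧ p = ρ m

namespace Separated

variable {ι : Type} {E : ι → ι → Prop} {ρ ρ' : ι → Plane} {I J : Set ι} {S T : Set Plane}

theorem symm (h : Separated E ρ I J) : Separated E ρ J I := by
  intro i hi j hj k hk l hl hij hkl hne p hp hp'
  obtain ⟨m, h₁, h₂, h₃⟩ := h k hk l hl i hi j hj hkl hij hne.symm p hp' hp
  exact ⟨m, h₂, h₁, h₃⟩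

theorem congr (h : Separated E ρ I J) (hI : Set.EqOn ρ ρ' I) (hJ : Set.EqOn ρ ρ' J) :
    Separated E ρ' I J := by
  intro i hi j hj k hk l hl hij hkl hne p hp hp'
  rw [← hI hi, ← hI hj] at hp
  rw [← hJ hk, ← hJ hl] at hp'
  obtain ⟨m, h₁, h₂, h₃⟩ := h i hi j hj k hk l hl hij hkl hne p hp hp'
  have hm : m ∈ I := by rcases h₁ with rfl | rfl <;> assumption
  exact ⟨m, h₁, h₂, by rw [h₃, hI hm]⟩

theorem of_mem_segment (h : Separated E ρ I I) {i j m : ι} (hi : i ∈ I) (hj : j ∈ I) (hm : m ∈ I)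
    (hij : i = j ∨ E i j) (hmem : ρ m ∈ segment ℝ (ρ i) (ρ j)) : m = i ∨ m = j := by
  by_cases hne : s(m, m) = s(i, j)
  · simp only [Sym2.eq_iff] at hne
    tauto
  · obtain ⟨n, h₁, h₂, -⟩ := h m hm m hm i hi j hj (Or.inl rfl) hij hne _
      (left_mem_segment ℝ _ _) hmem
    obtain rfl : n = m := by tauto
    exact h₂

theorem of_convex (hI : Separated E ρ I I) (hJ : Separated E ρ J J) (hS : Convex ℝ S)
    (hT : Convex ℝ T) (hIS : Set.MapsTo ρ I S) (hJT : Set.MapsTo ρ J T)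
    (hST : ∀ p ∈ S, p ∈ T → ∃ m ∈ I, m ∈ J ∧ p = ρ m) : Separated E ρ I J := by
  intro i hi j hj k hk l hl hij hkl hne p hp hp'
  obtain ⟨m, hmI, hmJ, rfl⟩ := hST p (hS.segment_subset (hIS hi) (hIS hj) hp)
    (hT.segment_subset (hJT hk) (hJT hl) hp')
  exact ⟨m, hI.of_mem_segment hi hj hmI hij hp, hJ.of_mem_segment hk hl hmJ hkl hp', rfl⟩

theorem pair {a b : ι} (hab : ρ a ≠ ρ b) : Separated E ρ {a, b} {a, b} := by
  rintro i hi j hj k hk l hl - - hne p hp hp'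
  have hab' := hab.symm
  rcases hi with rfl | rfl <;> rcases hj with rfl | rfl <;> rcases hk with rfl | rfl <;>
    rcases hl with rfl | rfl <;> simp_all [Sym2.eq_swap]

end Separated

/-! ### Drawing noncrossing graphs on the natural numbers -/

/-- A graph on `ℕ` all of whose edges join numbers of different parity, and whose edges do not
cross when drawn as arcs above the number line. -/
structure IsNoncrossing (E : ℕ → ℕ → Prop) : Prop where
  symm : ∀ i j, E i j → E j i
  odd : ∀ i j, E i j → Odd (i + j)
  noncrossing : ∀ i j k l, E i j → E k l → i < k → k < j → j < l → False

/-- The interval below an arc splits into three shorter ones that contain all edges below the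
arc. -/
theorem IsNoncrossing.exists_split {E : ℕ → ℕ → Prop} (hE : IsNoncrossing E) {a b : ℕ}
    (hab : a + 1 < b) (hodd : Odd (a + b)) :
    ∃ c d, a < c ∧ c < d ∧ d < b ∧ Odd (a + c) ∧ Odd (c + d) ∧ Odd (d + b) ∧
      ∀ i j, a ≤ i → i < j → j ≤ b → E i j →
        (i = a ∧ j = b) ∨ j ≤ c ∨ (c ≤ i ∧ j ≤ d) ∨ d ≤ i := by
  classical
  obtain ⟨c, hac, hcb, hcodd, hc, hcE⟩ : ∃ c, a < c ∧ c < b ∧ Odd (a + c) ∧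
      (c = a + 1 ∨ E a c) ∧ ∀ j, j < b → E a j → j ≤ c := by
    by_cases h : ∃ c, a < c ∧ c < b ∧ E a c
    · obtain ⟨c₀, h₁, h₂, h₃⟩ := h
      have hP : c₀ < b ∧ E a c₀ := ⟨h₂, h₃⟩
      have hs := Nat.findGreatest_spec (P := fun c ↦ c < b ∧ E a c) h₂.le hP
      have hle : c₀ ≤ _ := Nat.le_findGreatest (P := fun c ↦ c < b ∧ E a c) h₂.le hP
      exact ⟨_, h₁.trans_le hle, hs.1, hE.odd _ _ hs.2, Or.inr hs.2,
        fun j hj hj' ↦ Nat.le_findGreatest hj.le ⟨hj, hj'⟩⟩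
    · refine ⟨a + 1, by omega, hab, ⟨a, by ring⟩, Or.inl rfl, fun j hj hj' ↦ ?_⟩
      by_contra hlt
      exact h ⟨j, by omega, hj, hj'⟩
  have hcb' : c + 1 < b := by
    rcases hodd with ⟨x, hx⟩
    rcases hcodd with ⟨y, hy⟩
    omega
  obtain ⟨d, hcd, hdb, hdodd, hd, hdE⟩ : ∃ d, c < d ∧ d < b ∧ Odd (d + b) ∧
      (d = b - 1 ∨ E d b) ∧ ∀ i, c < i → i < b → E i b → d ≤ i := by
    by_cases h : ∃ d, c < d ∧ d < b ∧ E d b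
    · obtain ⟨h₁, h₂, h₃⟩ := Nat.find_spec h
      exact ⟨_, h₁, h₂, hE.odd _ _ h₃, Or.inr h₃,
        fun i hi hi' hi'' ↦ Nat.find_min' h ⟨hi, hi', hi''⟩⟩
    · refine ⟨b - 1, by omega, by omega, ⟨b - 1, by omega⟩, Or.inl rfl, fun i hi hi' hi'' ↦ ?_⟩
      exact absurd ⟨i, hi, hi', hi''⟩ h
  refine ⟨c, d, hac, hcd, hdb, hcodd, ?_, hdodd, fun i j hai hij hjb hEij ↦ ?_⟩
  · rw [Nat.odd_iff] at *
    omega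
  · by_contra! hcon
    obtain ⟨h₁, h₂, h₃, h₄⟩ := hcon
    have hEodd := hE.odd _ _ hEij
    rcases lt_or_ge i c with hic | hci
    · rcases hai.eq_or_lt with rfl | hai
      · have := hcE j (lt_of_le_of_ne hjb (h₁ rfl)) hEij
        omega
      · rcases hc with rfl | hc
        · omega
        · exact hE.noncrossing _ _ _ _ hc hEij hai hic h₂
    · rcases hjb.eq_or_lt with rfl | hjb
      · rcases hci.eq_or_lt with rfl | hci
        · rw [Nat.odd_iff] at *
          omega
        · have := hdE i hci hij hEij
          omega
      · rcases hd with rfl | hd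
        · have := h₃ hci
          omega
        · exact hE.noncrossing _ _ _ _ hEij hd h₄ (h₃ hci) hjb

/-- A noncrossing graph on an interval of natural numbers has a unit-length drawing in every
divergent wedge whose base has unit length, with the ends of the interval at the ends of the
base. -/
theorem IsNoncrossing.exists_drawing {E : ℕ → ℕ → Prop} (hE : IsNoncrossing E) (n : ℕ) :
    ∀ (a b : ℕ), b - a = n → a < b → Odd (a + b) → ∀ (p q d₁ d₂ : Plane), dist p q = 1 →
      Diverges (q - p) d₁ d₂ →
      ∃ ρ : ℕ → Plane, ρ a = p ∧ ρ b = q ∧ Set.MapsTo ρ (Set.Icc a b) (leftWedge p q d₁ d₂) ∧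
        (∀ i ∈ Set.Icc a b, ∀ j ∈ Set.Icc a b, E i j → dist (ρ i) (ρ j) = 1) ∧
        Separated E ρ (Set.Icc a b) (Set.Icc a b) := by
  induction n using Nat.strong_induction_on with
  | _ n ih =>
  intro a b hn hab hodd p q d₁ d₂ hpq hdiv
  have hpq' : p ≠ q := by
    rintro rfl
    simp at hpq
  have hself (i) (h : E i i) : False := by
    have := hE.odd i i h
    rw [Nat.odd_iff] at this
    omega
  rcases (Nat.succ_le_of_lt hab).eq_or_lt with rfl | hab'
  · have hIcc : Set.Icc a a.succ = {a, a.succ} := by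
      ext i
      simp only [Set.mem_Icc, Set.mem_insert_iff, Set.mem_singleton_iff]
      omega
    refine ⟨fun i ↦ if i = a then p else q, by simp, by simp, ?_, ?_, ?_⟩
    · intro i _
      dsimp only
      split_ifs
      exacts [hdiv.left_mem, hdiv.right_mem]
    · rw [hIcc]
      rintro i (rfl | rfl) j (rfl | rfl) hij
      · exact (hself _ hij).elim
      · simpa using hpq
      · simpa [dist_comm] using hpq
      · exact (hself _ hij).elim
    · rw [hIcc]
      exact Separated.pair (by simpa using hpq')
  obtain ⟨c, d, hac, hcd, hdb, hcodd, hcdodd, hdodd, hsplit⟩ := hE.exists_split hab' hodd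
  obtain ⟨p', q', f₁, g₁, g₂, f₂, hpp', hpq'', hqq', hL, hT, hR, hLW, hTW, hRW, hsL, hsT, hsR,
    hLT, hLR, hTR⟩ := hdiv.exists_rhombus
  obtain ⟨ρ₁, h₁a, h₁c, h₁W, h₁E, h₁S⟩ := ih (c - a) (by omega) a c rfl hac hcodd p p' d₁ f₁ hpp' hL
  obtain ⟨ρ₂, h₂c, h₂d, h₂W, h₂E, h₂S⟩ :=
    ih (d - c) (by omega) c d rfl hcd hcdodd p' q' g₁ g₂ (hpq''.trans hpq) hT
  obtain ⟨ρ₃, h₃d, h₃b, h₃W, h₃E, h₃S⟩ := ih (b - d) (by omega) d b rfl hdb hdodd q' q f₂ d₂ hqq' hR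
  obtain ⟨ρ, hρ₁, hρ₂, hρ₃⟩ : ∃ ρ : ℕ → Plane, Set.EqOn ρ₁ ρ (Set.Icc a c) ∧
      Set.EqOn ρ₂ ρ (Set.Icc c d) ∧ Set.EqOn ρ₃ ρ (Set.Icc d b) := by
    refine ⟨fun i ↦ if i ≤ c then ρ₁ i else if i ≤ d then ρ₂ i else ρ₃ i, ?_, ?_, ?_⟩
    · rintro i ⟨-, hi⟩
      simp [hi]
    · rintro i ⟨hi, hi'⟩
      rcases hi.eq_or_lt with rfl | hi
      · simp [h₁c, h₂c]
      · simp [hi.not_ge, hi']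
    · rintro i ⟨hi, -⟩
      have hic : ¬ i ≤ c := by omega
      rcases hi.eq_or_lt with rfl | hi
      · simp [hic, h₂d, h₃d]
      · simp [hic, hi.not_ge]
  have hρa : ρ a = p := by rw [← hρ₁ ⟨le_rfl, hac.le⟩, h₁a]
  have hρc : ρ c = p' := by rw [← hρ₁ ⟨hac.le, le_rfl⟩, h₁c]
  have hρd : ρ d = q' := by rw [← hρ₂ ⟨hcd.le, le_rfl⟩, h₂d]
  have hρb : ρ b = q := by rw [← hρ₃ ⟨hdb.le, le_rfl⟩, h₃b]
  replace h₁W := h₁W.congr hρ₁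
  replace h₂W := h₂W.congr hρ₂
  replace h₃W := h₃W.congr hρ₃
  replace h₁S := h₁S.congr hρ₁ hρ₁
  replace h₂S := h₂S.congr hρ₂ hρ₂
  replace h₃S := h₃S.congr hρ₃ hρ₃
  have h₀W : Set.MapsTo ρ {a, b} (segment ℝ p q) := by
    rintro i (rfl | rfl)
    · rw [hρa]; exact left_mem_segment ℝ _ _
    · rw [hρb]; exact right_mem_segment ℝ _ _
  have h₀S : Separated E ρ {a, b} {a, b} := Separated.pair (by rwa [hρa, hρb])
  have h₀C := convex_segment (𝕜 := ℝ) p q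
  have h₁C := convex_leftWedge p p' d₁ f₁
  have h₂C := convex_leftWedge p' q' g₁ g₂
  have h₃C := convex_leftWedge q' q f₂ d₂
  have h₀₁ := h₀S.of_convex h₁S h₀C h₁C h₀W h₁W fun x hx hx' ↦
    ⟨a, by simp, by simp [hac.le], by rw [hsL x hx hx', hρa]⟩
  have h₀₂ := h₀S.of_convex h₂S h₀C h₂C h₀W h₂W fun x hx hx' ↦ (hsT x hx hx').elim
  have h₀₃ := h₀S.of_convex h₃S h₀C h₃C h₀W h₃W fun x hx hx' ↦
    ⟨b, by simp, by simp [hdb.le], by rw [hsR x hx hx', hρb]⟩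
  have h₁₂ := h₁S.of_convex h₂S h₁C h₂C h₁W h₂W fun x hx hx' ↦
    ⟨c, by simp [hac.le], by simp [hcd.le], by rw [hLT x hx hx', hρc]⟩
  have h₁₃ := h₁S.of_convex h₃S h₁C h₃C h₁W h₃W fun x hx hx' ↦ (hLR x hx hx').elim
  have h₂₃ := h₂S.of_convex h₃S h₂C h₃C h₂W h₃W fun x hx hx' ↦
    ⟨d, by simp [hcd.le], by simp [hdb.le], by rw [hTR x hx hx', hρd]⟩
  have hcover : ∀ i ∈ Set.Icc a b, ∀ j ∈ Set.Icc a b, (i = j ∨ E i j) →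
      (i ∈ ({a, b} : Set ℕ) ∧ j ∈ ({a, b} : Set ℕ)) ∨ (i ∈ Set.Icc a c ∧ j ∈ Set.Icc a c) ∨
        (i ∈ Set.Icc c d ∧ j ∈ Set.Icc c d) ∨ (i ∈ Set.Icc d b ∧ j ∈ Set.Icc d b) := by
    rintro i ⟨hai, hib⟩ j ⟨haj, hjb⟩ hij
    simp only [Set.mem_insert_iff, Set.mem_singleton_iff, Set.mem_Icc]
    rcases lt_trichotomy i j with hlt | rfl | hlt
    · have := hsplit i j hai hlt hjb (hij.resolve_left hlt.ne)
      omega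
    · omega
    · have := hsplit j i haj hlt hib (hE.symm _ _ (hij.resolve_left hlt.ne'))
      omega
  refine ⟨ρ, hρa, hρb, ?_, ?_, ?_⟩
  · rintro i ⟨hai, hib⟩
    rcases le_total i c with hic | hci
    · exact hLW (h₁W ⟨hai, hic⟩)
    · rcases le_total i d with hid | hdi
      · exact hTW (h₂W ⟨hci, hid⟩)
      · exact hRW (h₃W ⟨hdi, hib⟩)
  · intro i hi j hj hij
    rcases hcover i hi j hj (Or.inr hij) with ⟨hi, hj⟩ | ⟨hi, hj⟩ | ⟨hi, hj⟩ | ⟨hi, hj⟩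
    · rcases hi with rfl | rfl <;> rcases hj with rfl | rfl
      · exact (hself _ hij).elim
      · rw [hρa, hρb, hpq]
      · rw [hρa, hρb, dist_comm, hpq]
      · exact (hself _ hij).elim
    · rw [← hρ₁ hi, ← hρ₁ hj, h₁E i hi j hj hij]
    · rw [← hρ₂ hi, ← hρ₂ hj, h₂E i hi j hj hij]
    · rw [← hρ₃ hi, ← hρ₃ hj, h₃E i hi j hj hij]
  · intro i hi j hj k hk l hl hij hkl
    rcases hcover i hi j hj hij with ⟨hi, hj⟩ | ⟨hi, hj⟩ | ⟨hi, hj⟩ | ⟨hi, hj⟩ <;>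
      rcases hcover k hk l hl hkl with ⟨hk, hl⟩ | ⟨hk, hl⟩ | ⟨hk, hl⟩ | ⟨hk, hl⟩
    exacts [h₀S i hi j hj k hk l hl hij hkl, h₀₁ i hi j hj k hk l hl hij hkl,
      h₀₂ i hi j hj k hk l hl hij hkl, h₀₃ i hi j hj k hk l hl hij hkl,
      h₀₁.symm i hi j hj k hk l hl hij hkl, h₁S i hi j hj k hk l hl hij hkl,
      h₁₂ i hi j hj k hk l hl hij hkl, h₁₃ i hi j hj k hk l hl hij hkl,
      h₀₂.symm i hi j hj k hk l hl hij hkl, h₁₂.symm i hi j hj k hk l hl hij hkl,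
      h₂S i hi j hj k hk l hl hij hkl, h₂₃ i hi j hj k hk l hl hij hkl,
      h₀₃.symm i hi j hj k hk l hl hij hkl, h₁₃.symm i hi j hj k hk l hl hij hkl,
      h₂₃.symm i hi j hj k hk l hl hij hkl, h₃S i hi j hj k hk l hl hij hkl]

/-! ### Vertices on a circle -/

/-- Four points in convex position span two crossing segments. -/
theorem exists_mem_segment_inter {s : ℝ} {P₁ P₂ P₃ P₄ : Plane}
    (h₁ : s * cross2 (P₃ - P₂) (P₄ - P₂) < 0) (h₂ : s * cross2 (P₃ - P₁) (P₄ - P₁) < 0)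
    (h₃ : s * cross2 (P₂ - P₁) (P₄ - P₁) < 0) (h₄ : s * cross2 (P₂ - P₁) (P₃ - P₁) < 0) :
    (segment ℝ P₁ P₃ ∩ segment ℝ P₂ P₄).Nonempty := by
  have hsum : cross2 (P₃ - P₂) (P₄ - P₂) + cross2 (P₂ - P₁) (P₄ - P₁) =
      cross2 (P₃ - P₁) (P₄ - P₁) + cross2 (P₂ - P₁) (P₃ - P₁) := by
    simp only [cross2, PiLp.sub_apply]; ring
  have hrel : cross2 (P₃ - P₂) (P₄ - P₂) • P₁ + cross2 (P₂ - P₁) (P₄ - P₁) • P₃ =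
      cross2 (P₃ - P₁) (P₄ - P₁) • P₂ + cross2 (P₂ - P₁) (P₃ - P₁) • P₄ := by
    ext i
    fin_cases i <;>
      simp only [cross2, PiLp.sub_apply, PiLp.add_apply, PiLp.smul_apply, smul_eq_mul,
        Fin.zero_eta, Fin.mk_one] <;> ring
  generalize cross2 (P₃ - P₂) (P₄ - P₂) = a₁ at *
  generalize cross2 (P₃ - P₁) (P₄ - P₁) = a₂ at *
  generalize cross2 (P₂ - P₁) (P₄ - P₁) = a₃ at *
  generalize cross2 (P₂ - P₁) (P₃ - P₁) = a₄ at *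
  have hS : s * (a₁ + a₃) < 0 := by linarith
  have hS₀ : a₁ + a₃ ≠ 0 := by
    rintro h
    rw [h] at hS
    linarith
  have hs : s ≠ 0 := by
    rintro rfl
    linarith
  have hpos {a : ℝ} (ha : s * a < 0) : 0 ≤ a / (a₁ + a₃) := by
    rw [← mul_div_mul_left a _ hs]
    exact div_nonneg_of_nonpos ha.le hS.le
  refine ⟨(a₁ / (a₁ + a₃)) • P₁ + (a₃ / (a₁ + a₃)) • P₃,
    ⟨_, _, hpos h₁, hpos h₃, by rw [← add_div, div_self hS₀], rfl⟩,
    ⟨_, _, hpos h₂, hpos h₄, by rw [← add_div, ← hsum, div_self hS₀], ?_⟩⟩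
  have := congrArg (fun v ↦ (a₁ + a₃)⁻¹ • v) hrel
  simp only [smul_add, smul_smul] at this
  simp only [div_eq_inv_mul]
  exact this.symm

/-- The slope parameter of a point `X` of the circle through the origin with center `k`: its
stereographic projection from the origin, up to scaling. -/
def circleParam (k X : Plane) : ℝ := cross2 k X / (X 0 ^ 2 + X 1 ^ 2)

section circleParam

variable {k X Y Z : Plane}

theorem sq_add_sq_pos (hX : X ≠ 0) : 0 < X 0 ^ 2 + X 1 ^ 2 := by
  by_contra h
  refine hX ?_
  ext i
  fin_cases i <;> simp <;> nlinarith [sq_nonneg (X 0), sq_nonneg (X 1)]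

theorem sq_add_sq_center (hX : X ≠ 0) (hXk : X 0 ^ 2 + X 1 ^ 2 = 2 * (X 0 * k 0 + X 1 * k 1)) :
    k 0 ^ 2 + k 1 ^ 2 = (X 0 ^ 2 + X 1 ^ 2) * (1 / 4 + circleParam k X ^ 2) := by
  have h := (sq_add_sq_pos hX).ne'
  have hc : circleParam k X * (X 0 ^ 2 + X 1 ^ 2) = cross2 k X := div_mul_cancel₀ _ h
  apply mul_left_cancel₀ h
  rw [cross2] at hc
  linear_combination (-(circleParam k X * (X 0 ^ 2 + X 1 ^ 2)) - (k 0 * X 1 - k 1 * X 0)) * hc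
    - (X 0 ^ 2 + X 1 ^ 2 + 2 * (X 0 * k 0 + X 1 * k 1)) / 4 * hXk

theorem cross2_eq_circleParam (hX : X ≠ 0) (hY : Y ≠ 0)
    (hXk : X 0 ^ 2 + X 1 ^ 2 = 2 * (X 0 * k 0 + X 1 * k 1))
    (hYk : Y 0 ^ 2 + Y 1 ^ 2 = 2 * (Y 0 * k 0 + Y 1 * k 1)) :
    2 * (k 0 ^ 2 + k 1 ^ 2) * cross2 X Y = (X 0 ^ 2 + X 1 ^ 2) * (Y 0 ^ 2 + Y 1 ^ 2) *
      (circleParam k Y - circleParam k X) := by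
  have hcX : circleParam k X * (X 0 ^ 2 + X 1 ^ 2) = cross2 k X :=
    div_mul_cancel₀ _ (sq_add_sq_pos hX).ne'
  have hcY : circleParam k Y * (Y 0 ^ 2 + Y 1 ^ 2) = cross2 k Y :=
    div_mul_cancel₀ _ (sq_add_sq_pos hY).ne'
  rw [cross2] at *
  linear_combination (Y 0 ^ 2 + Y 1 ^ 2) * hcX - (X 0 ^ 2 + X 1 ^ 2) * hcY
    + (k 0 * X 1 - k 1 * X 0) * hYk - (k 0 * Y 1 - k 1 * Y 0) * hXk

theorem cross2_sub_eq_circleParam (hX : X ≠ 0) (hY : Y ≠ 0) (hZ : Z ≠ 0)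
    (hXk : X 0 ^ 2 + X 1 ^ 2 = 2 * (X 0 * k 0 + X 1 * k 1))
    (hYk : Y 0 ^ 2 + Y 1 ^ 2 = 2 * (Y 0 * k 0 + Y 1 * k 1))
    (hZk : Z 0 ^ 2 + Z 1 ^ 2 = 2 * (Z 0 * k 0 + Z 1 * k 1)) :
    2 * (k 0 ^ 2 + k 1 ^ 2) ^ 2 * cross2 (Y - X) (Z - X) =
      (X 0 ^ 2 + X 1 ^ 2) * (Y 0 ^ 2 + Y 1 ^ 2) * (Z 0 ^ 2 + Z 1 ^ 2) *
      ((circleParam k Y - circleParam k X) * (circleParam k Z - circleParam k Y) *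
        (circleParam k Z - circleParam k X)) := by
  have hXY := cross2_eq_circleParam hX hY hXk hYk
  have hYZ := cross2_eq_circleParam hY hZ hYk hZk
  have hXZ := cross2_eq_circleParam hX hZ hXk hZk
  have hKX := sq_add_sq_center hX hXk
  have hKY := sq_add_sq_center hY hYk
  have hKZ := sq_add_sq_center hZ hZk
  have hsplit : cross2 (Y - X) (Z - X) = cross2 X Y + cross2 Y Z - cross2 X Z := by
    simp only [cross2, PiLp.sub_apply]; ring
  rw [hsplit]
  generalize cross2 X Y = xy at *
  generalize cross2 Y Z = yz at *
  generalize cross2 X Z = xz at *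
  generalize circleParam k X = x at *
  generalize circleParam k Y = y at *
  generalize circleParam k Z = z at *
  generalize X 0 ^ 2 + X 1 ^ 2 = a at *
  generalize Y 0 ^ 2 + Y 1 ^ 2 = b at *
  generalize Z 0 ^ 2 + Z 1 ^ 2 = c at *
  generalize k 0 ^ 2 + k 1 ^ 2 = K at *
  linear_combination K * (hXY + hYZ - hXZ) + a * b * (y - x) * hKZ + b * c * (z - y) * hKX
    - a * c * (z - x) * hKY

theorem circleParam_injective (hX : X ≠ 0) (hY : Y ≠ 0)
    (hXk : X 0 ^ 2 + X 1 ^ 2 = 2 * (X 0 * k 0 + X 1 * k 1))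
    (hYk : Y 0 ^ 2 + Y 1 ^ 2 = 2 * (Y 0 * k 0 + Y 1 * k 1))
    (h : circleParam k X = circleParam k Y) : X = Y := by
  have hpos : 0 < 1 / 4 + circleParam k Y ^ 2 := by positivity
  have hKX := sq_add_sq_center hX hXk
  have hKY := sq_add_sq_center hY hYk
  have hK : 0 < k 0 ^ 2 + k 1 ^ 2 := hKY ▸ mul_pos (sq_add_sq_pos hY) hpos
  rw [h, hKY] at hKX
  have hXY := mul_right_cancel₀ hpos.ne' hKX
  have hcX : circleParam k X * (X 0 ^ 2 + X 1 ^ 2) = cross2 k X :=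
    div_mul_cancel₀ _ (sq_add_sq_pos hX).ne'
  have hcY : circleParam k Y * (Y 0 ^ 2 + Y 1 ^ 2) = cross2 k Y :=
    div_mul_cancel₀ _ (sq_add_sq_pos hY).ne'
  rw [h, ← hXY, hcY] at hcX
  rw [hXk, hYk] at hXY
  rw [cross2, cross2] at hcX
  ext i
  fin_cases i
  · apply mul_left_cancel₀ hK.ne'
    simp only [Fin.zero_eta]
    linear_combination -k 0 / 2 * hXY + k 1 * hcX
  · apply mul_left_cancel₀ hK.ne'
    simp only [Fin.mk_one]
    linear_combination -k 1 / 2 * hXY - k 0 * hcX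

end circleParam

/-- The vertices of a graph drawn on a circle can be ordered along the circle, starting from `u`
and ending in `w`, if all other vertices are on one side of the chord from `u` to `w`. -/
theorem exists_circular_order {V : Type} [Finite V] {G : SimpleGraph V} {σ : V → Plane} {c : Plane}
    {r s : ℝ} {u w : V} (huw : u ≠ w) (hσ : IsPlanarDrawing G σ) (hr : ∀ x, dist (σ x) c = r)
    (hs : ∀ x, x ≠ u → x ≠ w → 0 < s * cross2 (σ w - σ u) (σ x - σ u)) (hs₀ : s ≠ 0) :
    ∃ f : V → ℝ, Function.Injective f ∧ (∀ x, f u ≤ f x) ∧ (∀ x, f x ≤ f w) ∧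
      ∀ i j k l, G.Adj i j → G.Adj k l → f i < f k → f k < f j → f j < f l → False := by
  classical
  have hcircle (x : V) : (σ x - σ u) 0 ^ 2 + (σ x - σ u) 1 ^ 2 =
      2 * ((σ x - σ u) 0 * (c - σ u) 0 + (σ x - σ u) 1 * (c - σ u) 1) := by
    have h := (hr x).trans (hr u).symm
    rw [EuclideanSpace.dist_eq, EuclideanSpace.dist_eq, Real.sqrt_inj (by positivity)
      (by positivity)] at h
    simp only [Fin.sum_univ_two, Real.dist_eq, sq_abs] at h
    simp only [PiLp.sub_apply]
    linear_combination h
  have hne {x : V} (hx : x ≠ u) : σ x - σ u ≠ 0 := sub_ne_zero.2 (hσ.1.ne hx)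
  have hapos {x : V} (hx : x ≠ u) := sq_add_sq_pos (hne hx)
  have hK : 0 < (c - σ u) 0 ^ 2 + (c - σ u) 1 ^ 2 := by
    rw [sq_add_sq_center (hne huw.symm) (hcircle w)]
    exact mul_pos (hapos huw.symm) (by positivity)
  let t (x : V) : ℝ := circleParam (c - σ u) (σ x - σ u)
  obtain ⟨M, hM⟩ : ∃ M, ∀ x, M < -s * t x := by
    obtain ⟨M, hM⟩ := (Set.finite_range fun x ↦ -s * t x).bddBelow
    exact ⟨M - 1, fun x ↦ by linarith [hM ⟨x, rfl⟩]⟩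
  let f (x : V) : ℝ := if x = u then M else -s * t x
  have hfu : f u = M := if_pos rfl
  have hf {x : V} (hx : x ≠ u) : f x = -s * t x := if_neg hx
  have hlt {x : V} (hx : x ≠ u) : f u < f x := by rw [hfu, hf hx]; exact hM x
  have hle (x : V) : f u ≤ f x := by
    by_cases hx : x = u
    · rw [hx]
    · exact (hlt hx).le
  have hcross {x y : V} (hx : x ≠ u) (hy : y ≠ u) :
      2 * ((c - σ u) 0 ^ 2 + (c - σ u) 1 ^ 2) * (s * cross2 (σ x - σ u) (σ y - σ u)) =
        ((σ x - σ u) 0 ^ 2 + (σ x - σ u) 1 ^ 2) * ((σ y - σ u) 0 ^ 2 + (σ y - σ u) 1 ^ 2) *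
          (f x - f y) := by
    have := cross2_eq_circleParam (hne hx) (hne hy) (hcircle x) (hcircle y)
    rw [hf hx, hf hy]
    linear_combination s * this
  have horient {x y z : V} (hxy : f x < f y) (hyz : f y < f z) :
      s * cross2 (σ y - σ x) (σ z - σ x) < 0 := by
    have hy : y ≠ u := by rintro rfl; exact absurd hxy (hle x).not_gt
    have hz : z ≠ u := by rintro rfl; exact absurd hyz (hle y).not_gt
    by_cases hx : x = u
    · subst hx
      have h := hcross hy hz
      refine neg_of_mul_neg_right (a := 2 * ((c - σ x) 0 ^ 2 + (c - σ x) 1 ^ 2)) ?_ (by positivity)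
      rw [h]
      exact mul_neg_of_pos_of_neg (mul_pos (hapos hy) (hapos hz)) (by linarith)
    · have h := cross2_sub_eq_circleParam (hne hx) (hne hy) (hne hz) (hcircle x) (hcircle y)
        (hcircle z)
      rw [sub_sub_sub_cancel_right, sub_sub_sub_cancel_right] at h
      rw [hf hx, hf hy] at hxy
      rw [hf hy, hf hz] at hyz
      refine neg_of_mul_neg_right (a := s ^ 2 * (2 * ((c - σ u) 0 ^ 2 + (c - σ u) 1 ^ 2) ^ 2)) ?_
        (by positivity)
      have h' : s ^ 2 * (2 * ((c - σ u) 0 ^ 2 + (c - σ u) 1 ^ 2) ^ 2) *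
          (s * cross2 (σ y - σ x) (σ z - σ x)) =
          -(((σ x - σ u) 0 ^ 2 + (σ x - σ u) 1 ^ 2) * ((σ y - σ u) 0 ^ 2 + (σ y - σ u) 1 ^ 2) *
            ((σ z - σ u) 0 ^ 2 + (σ z - σ u) 1 ^ 2) * ((-s * t y - -s * t x) *
              (-s * t z - -s * t y) * (-s * t z - -s * t x))) := by
        linear_combination s ^ 3 * h
      rw [h', neg_lt_zero]
      exact mul_pos (mul_pos (mul_pos (hapos hx) (hapos hy)) (hapos hz))
        (mul_pos (mul_pos (by linarith) (by linarith)) (by linarith))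
  refine ⟨f, ?_, hle, ?_, ?_⟩
  · intro x y hxy
    by_cases hx : x = u
    · by_contra hy
      subst hx
      exact (hlt (Ne.symm hy)).ne hxy
    · by_cases hy : y = u
      · subst hy
        exact absurd hxy (hlt hx).ne'
      · rw [hf hx, hf hy] at hxy
        refine hσ.1 (sub_left_injective (circleParam_injective (hne hx) (hne hy) (hcircle x)
          (hcircle y) (mul_left_cancel₀ (neg_ne_zero.2 hs₀) hxy)))
  · intro x
    by_cases hx : x = u
    · rw [hx]; exact hle w
    by_cases hxw : x = w
    · rw [hxw]
    have h := hcross huw.symm hx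
    have h₁ := mul_pos (mul_pos two_pos hK) (hs x hx hxw)
    rw [h] at h₁
    have := pos_of_mul_pos_right h₁ (mul_pos (hapos huw.symm) (hapos hx)).le
    linarith
  · intro i j k l hij hkl hik hkj hjl
    obtain ⟨p, hp⟩ := exists_mem_segment_inter (horient hkj hjl) (horient (hik.trans hkj) hjl)
      (horient hik (hkj.trans hjl)) (horient hik hkj)
    have hik' : i ≠ k := by rintro rfl; exact hik.false
    have hkj' : k ≠ j := by rintro rfl; exact hkj.false
    have hjl' : j ≠ l := by rintro rfl; exact hjl.false
    have hil' : i ≠ l := by rintro rfl; exact (hik.trans (hkj.trans hjl)).false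
    rw [hσ.2.2 i j k l hij hkl (by simp [hik', hil'])] at hp
    obtain ⟨m, h₁, h₂, -⟩ := hp
    rcases h₁ with rfl | rfl <;> rcases h₂ with rfl | rfl <;> contradiction

/-! ### The main theorem -/

/-- A bipartite graph with a noncrossing linear order of its vertices has a unit-length drawing in
every divergent wedge whose base has unit length, with the first and the last vertex at the ends of
the base. -/
theorem exists_leftWedge_drawing {V : Type} [Finite V] {G : SimpleGraph V} {u w : V}
    (hG : G.Colorable 2) (hadj : G.Adj u w) {f : V → ℝ} (hf : Function.Injective f)
    (hu : ∀ x, f u ≤ f x) (hw : ∀ x, f x ≤ f w)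
    (hnc : ∀ i j k l, G.Adj i j → G.Adj k l → f i < f k → f k < f j → f j < f l → False)
    {p₁ p₂ d₁ d₂ : Plane} (hp : dist p₁ p₂ = 1) (hd : Diverges (p₂ - p₁) d₁ d₂) :
    ∃ ρ : V → Plane, IsPlanarDrawing G ρ ∧ ρ u = p₁ ∧ ρ w = p₂ ∧
      (∀ x y : V, G.Adj x y → dist (ρ x) (ρ y) = 1) ∧ ∀ x, ρ x ∈ leftWedge p₁ p₂ d₁ d₂ := by
  classical
  cases nonempty_fintype V
  obtain ⟨C⟩ := hG
  let g (x : V) : ℕ := 2 * (Finset.univ.filter fun y ↦ f y < f x).card + (C x : ℕ)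
  have hg {x y : V} (hxy : f x < f y) : g x < g y := by
    have : (Finset.univ.filter fun z ↦ f z < f x).card <
        (Finset.univ.filter fun z ↦ f z < f y).card := by
      refine Finset.card_lt_card (Finset.ssubset_iff_of_subset ?_ |>.2 ⟨x, ?_, ?_⟩)
      · intro z hz
        simp only [Finset.mem_filter, Finset.mem_univ, true_and] at hz ⊢
        exact hz.trans hxy
      · simpa using hxy
      · simp
    have h₁ := (C x).isLt
    simp only [g]
    omega
  have hglt {x y : V} : g x < g y ↔ f x < f y := by
    refine ⟨fun h ↦ ?_, hg⟩
    rcases lt_trichotomy (f x) (f y) with hlt | heq | hlt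
    · exact hlt
    · rw [hf heq] at h
      exact h.false.elim
    · exact absurd h (hg hlt).asymm
  have hginj : Function.Injective g := by
    intro x y h
    rcases lt_trichotomy (f x) (f y) with hlt | heq | hlt
    · exact absurd h (hg hlt).ne
    · exact hf heq
    · exact absurd h (hg hlt).ne'
  have hgodd {x y : V} (h : G.Adj x y) : Odd (g x + g y) := by
    have h₁ := (C x).isLt
    have h₂ := (C y).isLt
    have h₃ : (C x : ℕ) ≠ C y := fun h' ↦ C.valid h (Fin.ext h')
    rw [Nat.odd_iff]
    simp only [g]
    omega
  have hE : IsNoncrossing fun i j ↦ ∃ x y, G.Adj x y ∧ g x = i ∧ g y = j := by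
    refine ⟨?_, ?_, ?_⟩
    · rintro _ _ ⟨x, y, h, rfl, rfl⟩
      exact ⟨y, x, h.symm, rfl, rfl⟩
    · rintro _ _ ⟨x, y, h, rfl, rfl⟩
      exact hgodd h
    · rintro _ _ _ _ ⟨x, y, h, rfl, rfl⟩ ⟨x', y', h', rfl, rfl⟩ h₁ h₂ h₃
      exact hnc x y x' y' h h' (hglt.1 h₁) (hglt.1 h₂) (hglt.1 h₃)
  have huw : f u < f w := lt_of_le_of_ne (hu w) (hf.ne hadj.ne)
  have hmem (x : V) : g x ∈ Set.Icc (g u) (g w) := by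
    constructor
    · rcases (hu x).eq_or_lt with h | h
      · rw [hf h]
      · exact (hg h).le
    · rcases (hw x).eq_or_lt with h | h
      · rw [hf h]
      · exact (hg h).le
  obtain ⟨ρ, hρu, hρw, hρW, hρE, hρS⟩ :=
    hE.exists_drawing _ (g u) (g w) rfl (hg huw) (hgodd hadj) p₁ p₂ d₁ d₂ hp hd
  have hsep (x y x' y' : V) (h : x = y ∨ G.Adj x y) (h' : x' = y' ∨ G.Adj x' y')
      (hne : s(x, y) ≠ s(x', y')) (p : Plane) (hp : p ∈ segment ℝ (ρ (g x)) (ρ (g y)))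
      (hp' : p ∈ segment ℝ (ρ (g x')) (ρ (g y'))) :
      ∃ m, (m = x ∨ m = y) ∧ (m = x' ∨ m = y') ∧ p = ρ (g m) := by
    obtain ⟨m, h₁, h₂, h₃⟩ := hρS _ (hmem x) _ (hmem y) _ (hmem x') _ (hmem y')
      (h.imp (congrArg g) fun h ↦ ⟨x, y, h, rfl, rfl⟩)
      (h'.imp (congrArg g) fun h ↦ ⟨x', y', h, rfl, rfl⟩)
      (fun heq ↦ hne (Sym2.map.injective hginj heq)) p hp hp'
    have : ∃ z, m = g z := by rcases h₁ with rfl | rfl <;> exact ⟨_, rfl⟩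
    obtain ⟨z, rfl⟩ := this
    exact ⟨z, h₁.imp (@hginj _ _) (@hginj _ _), h₂.imp (@hginj _ _) (@hginj _ _), h₃⟩
  refine ⟨ρ ∘ g, ⟨?_, ?_, ?_⟩, hρu, hρw, ?_, fun x ↦ hρW (hmem x)⟩
  · intro x y hxy
    by_contra hne
    obtain ⟨m, h₁, h₂, -⟩ := hsep x x y y (Or.inl rfl) (Or.inl rfl) (by simpa [Sym2.eq_iff] using hne)
      (ρ (g x)) (left_mem_segment ℝ _ _) (by
        have : ρ (g x) = ρ (g y) := hxy
        rw [this]; exact left_mem_segment ℝ _ _)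
    simp only [or_self] at h₁ h₂
    exact hne (h₁.symm.trans h₂)
  · intro x y z hxy hzx hzy hz
    obtain ⟨m, h₁, h₂, -⟩ := hsep z z x y (Or.inl rfl) (Or.inr hxy)
      (by simp [hzx, hzy]) _ (left_mem_segment ℝ _ _) hz
    simp only [or_self] at h₁
    subst h₁
    exact h₂.elim hzx hzy
  · intro x y x' y' hxy hxy' hne
    ext p
    constructor
    · rintro ⟨h, h'⟩
      exact hsep x y x' y' (Or.inr hxy) (Or.inr hxy') hne p h h'
    · rintro ⟨m, h, h', rfl⟩
      constructor
      · rcases h with rfl | rfl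
        exacts [left_mem_segment ℝ _ _, right_mem_segment ℝ _ _]
      · rcases h' with rfl | rfl
        exacts [left_mem_segment ℝ _ _, right_mem_segment ℝ _ _]
  · intro x y hxy
    exact hρE _ (hmem x) _ (hmem y) ⟨x, y, hxy, rfl, rfl⟩

theorem mem_closedHalfPlane {p dir ref x : Plane} : x ∈ closedHalfPlane p dir ref ↔
    0 ≤ cross2 dir (x - p) * cross2 dir (ref - p) :=
  Iff.rfl

theorem Diverges.leftWedge_subset_wedge {p₁ p₂ d₁ d₂ : Plane} (h : Diverges (p₂ - p₁) d₁ d₂) :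
    leftWedge p₁ p₂ d₁ d₂ ⊆ wedge p₁ p₂ d₁ d₂ := by
  rintro x ⟨h₁, h₂, h₃⟩
  refine ⟨⟨?_, ?_⟩, ?_⟩ <;> rw [mem_closedHalfPlane]
  · rw [add_sub_cancel_left]
    exact mul_nonneg h₁ h.left_fst.le
  · rw [cross2_swap _ d₁, cross2_swap _ d₁, neg_mul_neg]
    exact mul_nonneg h₂ h.left_fst.le
  · rw [cross2_swap (p₁ - p₂) d₂, ← cross2_neg_left, neg_sub]
    exact mul_nonneg h₃ h.left_snd.le

theorem Diverges.wedge_subset_wedge_swap {p₁ p₂ d₁ d₂ : Plane} (h : Diverges (p₂ - p₁) d₁ d₂) :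
    wedge p₁ p₂ d₁ d₂ ⊆ wedge p₂ p₁ d₂ d₁ := by
  rintro x ⟨⟨h₁, h₂⟩, h₃⟩
  refine ⟨⟨?_, h₃⟩, h₂⟩
  rw [mem_closedHalfPlane, add_sub_cancel_left] at *
  have hx : cross2 (p₁ - p₂) (x - p₂) = -cross2 (p₂ - p₁) (x - p₁) := by
    simp only [cross2, PiLp.sub_apply]; ring
  rw [hx, ← neg_sub p₂ p₁, cross2_neg_left, neg_mul_neg]
  exact mul_nonneg (nonneg_of_mul_nonneg_left h₁ h.left_fst) h.left_snd.le

open InnerProductGeometry in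
/-- Left-pointing unit vectors at the ends of a unit segment whose interior angles have sum greater
than `π` diverge. -/
theorem diverges_of_angle {p₁ p₂ d₁ d₂ : Plane} (hp : dist p₁ p₂ = 1) (hd₁ : ‖d₁‖ = 1)
    (hd₂ : ‖d₂‖ = 1) (h₁ : 0 < cross2 (p₂ - p₁) d₁) (h₂ : 0 < cross2 (p₂ - p₁) d₂)
    (hangle : Real.pi < angle d₁ (p₂ - p₁) + angle d₂ (p₁ - p₂)) :
    Diverges (p₂ - p₁) d₁ d₂ := by
  refine ⟨h₁, h₂, ?_⟩
  rw [dist_comm, dist_eq_norm] at hp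
  rw [← neg_sub p₂ p₁, angle_neg_right] at hangle
  generalize p₂ - p₁ = b at *
  have hcos := Real.cos_lt_cos_of_nonneg_of_le_pi (angle_nonneg d₂ b) (angle_le_pi d₁ b)
    (by linarith)
  rw [cos_angle, cos_angle, hd₁, hd₂, hp] at hcos
  simp only [PiLp.inner_apply, Fin.sum_univ_two, RCLike.inner_apply, conj_trivial, mul_one,
    div_one] at hcos
  rw [EuclideanSpace.norm_eq, Real.sqrt_eq_one] at hp hd₁ hd₂
  simp only [Fin.sum_univ_two, Real.norm_eq_abs, sq_abs] at hp hd₁ hd₂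
  have key {D₁ D₂ A₁ A₂ : ℝ} (hD : D₁ < D₂) (hA₁ : 0 < A₁) (hA₂ : 0 < A₂)
      (hu₁ : D₁ ^ 2 + A₁ ^ 2 = 1) (hu₂ : D₂ ^ 2 + A₂ ^ 2 = 1) : 0 < D₂ * A₁ - A₂ * D₁ := by
    rcases le_or_gt 0 D₁ with h | h
    · have : A₂ < A₁ := by nlinarith
      nlinarith
    · rcases le_or_gt 0 D₂ with h' | h'
      · nlinarith
      · have : A₁ < A₂ := by nlinarith
        nlinarith
  have := key hcos h₁ h₂ (by rw [cross2]; linear_combination hd₁ + (d₁ 0 ^ 2 + d₁ 1 ^ 2) * hp)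
    (by rw [cross2]; linear_combination hd₂ + (d₂ 0 ^ 2 + d₂ 1 ^ 2) * hp)
  refine this.trans_eq ?_
  simp only [cross2]
  linear_combination (d₂ 0 * d₁ 1 - d₂ 1 * d₁ 0) * hp

open InnerProductGeometry in
/-- A maximal bipartite outerplanar graph with a distinguished external edge
`{u,w}` admits a unit-length planar straight-line drawing inside any wedge with wedge
angle greater than π and base drawn as a prescribed unit segment. -/
theorem maximalBipartiteOuterplanar_wedge_drawing {V : Type} [Fintype V]
    (G : SimpleGraph V) (u w : V)
    (hmax : IsMaximalBipartiteOuterplanar G) (hadj : G.Adj u w)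
    (hcons : ConsecutiveInSomeCircleDrawing G u w)
    (p₁ p₂ d₁ d₂ : Plane) (hp : dist p₁ p₂ = 1)
    (hd₁ : ‖d₁‖ = 1) (hd₂ : ‖d₂‖ = 1)
    (hside : 0 < cross2 (p₂ - p₁) d₁ * cross2 (p₂ - p₁) d₂)
    (hangle : Real.pi < angle d₁ (p₂ - p₁) + angle d₂ (p₁ - p₂)) :
    ∃ ρ : V → Plane, IsPlanarDrawing G ρ ∧ ρ u = p₁ ∧ ρ w = p₂ ∧
      (∀ x y : V, G.Adj x y → dist (ρ x) (ρ y) = 1) ∧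
      (∀ x y : V, G.Adj x y → segment ℝ (ρ x) (ρ y) ⊆ wedge p₁ p₂ d₁ d₂) := by
  obtain ⟨σ, c, r, hσ, hr, hside'⟩ := hcons
  obtain ⟨s, hs₀, hs⟩ : ∃ s : ℝ, s ≠ 0 ∧
      ∀ x, x ≠ u → x ≠ w → 0 < s * cross2 (σ w - σ u) (σ x - σ u) := by
    rcases hside' with h | h
    · exact ⟨1, one_ne_zero, fun x hx hx' ↦ by simpa using h x hx hx'⟩
    · exact ⟨-1, by norm_num, fun x hx hx' ↦ by simpa using h x hx hx'⟩
  obtain ⟨f, hf, hfu, hfw, hnc⟩ := exists_circular_order hadj.ne hσ hr hs hs₀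
  rcases pos_and_pos_or_neg_and_neg_of_mul_pos hside with ⟨h₁, h₂⟩ | ⟨h₁, h₂⟩
  · have hdiv := diverges_of_angle hp hd₁ hd₂ h₁ h₂ hangle
    obtain ⟨ρ, hρ, hρu, hρw, hρ₁, hρW⟩ :=
      exists_leftWedge_drawing hmax.1 hadj hf hfu hfw hnc hp hdiv
    exact ⟨ρ, hρ, hρu, hρw, hρ₁, fun x y _ ↦ ((convex_leftWedge _ _ _ _).segment_subset (hρW x)
      (hρW y)).trans hdiv.leftWedge_subset_wedge⟩
  · rw [← neg_pos, ← cross2_neg_left, neg_sub] at h₁ h₂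
    rw [dist_comm] at hp
    rw [add_comm] at hangle
    have hdiv := diverges_of_angle hp hd₂ hd₁ h₂ h₁ hangle
    obtain ⟨ρ, hρ, hρw, hρu, hρ₁, hρW⟩ :=
      exists_leftWedge_drawing (f := fun x ↦ -f x) hmax.1 hadj.symm (neg_injective.comp hf)
        (fun x ↦ neg_le_neg (hfw x)) (fun x ↦ neg_le_neg (hfu x))
        (fun i j k l hij hkl hik hkj hjl ↦ hnc l k j i hkl.symm hij.symm (neg_lt_neg_iff.1 hjl)
          (neg_lt_neg_iff.1 hkj) (neg_lt_neg_iff.1 hik)) hp hdiv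
    exact ⟨ρ, hρ, hρu, hρw, hρ₁, fun x y _ ↦ ((convex_leftWedge _ _ _ _).segment_subset (hρW x)
      (hρW y)).trans (hdiv.leftWedge_subset_wedge.trans hdiv.wedge_subset_wedge_swap)⟩
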